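/- Let α ∈ (0,1) be irrational and let N be an integer with q_n ≤ N < q_{n+1} and Ostrowski expansion N = Σ_{ℓ=0}^{n} b_ℓ q_ℓ. Fix 0 ≤ k ≤ n. If b_{k+r} = 0 for all 1 ≤ r ≤ n − k, then ε_{k,0}(N) = 0. Otherwise, letting r* = min{ r ≥ 1 : b_{k+r} > 0 }, one has ε_{k,0}(N) > 0 if r* is even and ε_{k,0}(N) < 0 if r* is odd. -/

import Mathlib

/-- The Gauss map `x ↦ {1/x}`. -/
noncomputable def gaussMap (x : ℝ) : ℝ := Int.fract x⁻¹

/-- `pq α i` is the `i`-th partial quotient `aᵢ` of the continued fraction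
expansion `α = [0; a₁, a₂, …]` of an irrational `α ∈ (0,1)` (meaningful for `i ≥ 1`). -/
noncomputable def pq (α : ℝ) (i : ℕ) : ℕ := ⌊(gaussMap^[i - 1] α)⁻¹⌋₊

/-- `qden α k` is the denominator `q_k` of the `k`-th convergent of `α`:
`q₀ = 1`, `q₁ = a₁`, `q_{k+2} = a_{k+2} q_{k+1} + q_k`. -/
noncomputable def qden (α : ℝ) : ℕ → ℕ
  | 0 => 1
  | 1 => pq α 1
  | (k + 2) => pq α (k + 2) * qden α (k + 1) + qden α k

/-- Distance to the nearest integer. -/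
noncomputable def nint (x : ℝ) : ℝ := |x - round x|

/-- `δ_k = ‖q_k α‖`. -/
noncomputable def dlt (α : ℝ) (k : ℕ) : ℝ := nint (qden α k * α)

/-- `ε_{i,t}(N) = q_i (t δ_i + Σ_{j=1}^{n-i} (-1)^j b_{i+j} δ_{i+j})`,
where `b` are the Ostrowski digits of `N` with top index `n`. -/
noncomputable def eps (α : ℝ) (b : ℕ → ℕ) (n i t : ℕ) : ℝ :=
  (qden α i : ℝ) *
    (t * dlt α i + ∑ j ∈ Finset.Icc 1 (n - i), (-1 : ℝ) ^ j * b (i + j) * dlt α (i + j))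

theorem gaussMap_iterate_mem {α : ℝ} (h0 : 0 < α) (h1 : α < 1) (hirr : Irrational α) (k : ℕ) :
    0 < gaussMap^[k] α ∧ gaussMap^[k] α < 1 ∧ Irrational (gaussMap^[k] α) := by
  induction k with
  | zero => exact ⟨h0, h1, hirr⟩
  | succ k ih =>
    rw [Function.iterate_succ_apply']
    have hi : Irrational (gaussMap (gaussMap^[k] α)) := by
      unfold gaussMap
      exact (irrational_inv_iff.2 ih.2.2).sub_intCast _
    exact ⟨lt_of_le_of_ne (Int.fract_nonneg _) hi.ne_zero.symm, Int.fract_lt_one _, hi⟩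

theorem gaussMap_iterate_succ {α : ℝ} (h0 : 0 < α) (h1 : α < 1) (hirr : Irrational α) (k : ℕ) :
    gaussMap^[k + 1] α = (gaussMap^[k] α)⁻¹ - pq α (k + 1) := by
  rw [Function.iterate_succ_apply', pq, Nat.add_sub_cancel,
    natCast_floor_eq_intCast_floor (inv_nonneg.2 (gaussMap_iterate_mem h0 h1 hirr k).1.le)]
  rfl

theorem one_le_pq_succ {α : ℝ} (h0 : 0 < α) (h1 : α < 1) (hirr : Irrational α) (k : ℕ) :
    1 ≤ pq α (k + 1) := by
  obtain ⟨hpos, hlt, -⟩ := gaussMap_iterate_mem h0 h1 hirr k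
  rw [pq, Nat.add_sub_cancel, Nat.one_le_floor_iff]
  exact (one_lt_inv₀ hpos).2 hlt |>.le

theorem qden_pos {α : ℝ} (h0 : 0 < α) (h1 : α < 1) (hirr : Irrational α) :
    ∀ k, 0 < qden α k
  | 0 => Nat.one_pos
  | 1 => one_le_pq_succ h0 h1 hirr 0
  | k + 2 => Nat.add_pos_right _ (qden_pos h0 h1 hirr k)

/-- The product of the first `k + 1` iterates of `α` under the Gauss map. -/
noncomputable def gaussProd (α : ℝ) (k : ℕ) : ℝ := ∏ i ∈ Finset.range (k + 1), gaussMap^[i] α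

theorem gaussProd_pos {α : ℝ} (h0 : 0 < α) (h1 : α < 1) (hirr : Irrational α) (k : ℕ) :
    0 < gaussProd α k :=
  Finset.prod_pos fun i _ => (gaussMap_iterate_mem h0 h1 hirr i).1

theorem gaussProd_succ (α : ℝ) (k : ℕ) :
    gaussProd α (k + 1) = gaussProd α k * gaussMap^[k + 1] α :=
  Finset.prod_range_succ _ _

theorem gaussProd_one {α : ℝ} (h0 : 0 < α) (h1 : α < 1) (hirr : Irrational α) :
    gaussProd α 1 = 1 - pq α 1 * α := by
  have h := gaussMap_iterate_succ h0 h1 hirr 0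
  rw [gaussProd_succ, h]
  simp only [gaussProd, Function.iterate_zero, id, zero_add, Finset.prod_range_one]
  field_simp

theorem gaussProd_add_two {α : ℝ} (h0 : 0 < α) (h1 : α < 1) (hirr : Irrational α) (k : ℕ) :
    gaussProd α (k + 2) = gaussProd α k - pq α (k + 2) * gaussProd α (k + 1) := by
  have hx := (gaussMap_iterate_mem h0 h1 hirr (k + 1)).1.ne'
  rw [gaussProd_succ, gaussMap_iterate_succ h0 h1 hirr (k + 1), gaussProd_succ]
  field_simp

theorem exists_qden_mul_sub_eq {α : ℝ} (h0 : 0 < α) (h1 : α < 1) (hirr : Irrational α) :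
    ∀ k, ∃ p : ℤ, qden α k * α - p = (-1) ^ k * gaussProd α k
  | 0 => ⟨0, by simp [qden, gaussProd]⟩
  | 1 => ⟨1, by rw [gaussProd_one h0 h1 hirr, qden]; push_cast; ring⟩
  | k + 2 => by
    obtain ⟨p, hp⟩ := exists_qden_mul_sub_eq h0 h1 hirr k
    obtain ⟨p', hp'⟩ := exists_qden_mul_sub_eq h0 h1 hirr (k + 1)
    refine ⟨pq α (k + 2) * p' + p, ?_⟩
    rw [gaussProd_add_two h0 h1 hirr, qden]
    push_cast
    linear_combination (pq α (k + 2) : ℝ) * hp' + hp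

theorem gaussProd_succ_lt_half {α : ℝ} (h0 : 0 < α) (h1 : α < 1) (hirr : Irrational α) (k : ℕ) :
    gaussProd α (k + 1) < 1 / 2 := by
  induction k with
  | zero =>
    have ha : (1 : ℝ) ≤ pq α 1 := mod_cast one_le_pq_succ h0 h1 hirr 0
    have hlt : gaussProd α 1 < α := by
      rw [gaussProd_succ]
      simpa [gaussProd] using
        mul_lt_mul_of_pos_left (gaussMap_iterate_mem h0 h1 hirr 1).2.1 h0
    have hone := gaussProd_one h0 h1 hirr
    rw [zero_add]
    nlinarith
  | succ k ih =>
    rw [gaussProd_succ]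
    nlinarith [gaussProd_pos h0 h1 hirr (k + 1), (gaussMap_iterate_mem h0 h1 hirr (k + 2)).2.1]

theorem dlt_succ {α : ℝ} (h0 : 0 < α) (h1 : α < 1) (hirr : Irrational α) (k : ℕ) :
    dlt α (k + 1) = gaussProd α (k + 1) := by
  obtain ⟨p, hp⟩ := exists_qden_mul_sub_eq h0 h1 hirr (k + 1)
  have hpos := gaussProd_pos h0 h1 hirr (k + 1)
  have habs : |(qden α (k + 1) : ℝ) * α - p| = gaussProd α (k + 1) := by
    rw [hp, abs_mul, abs_neg_one_pow, one_mul, abs_of_pos hpos]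
  have hround : round ((qden α (k + 1) : ℝ) * α) = p := by
    have hlt := abs_lt.1 (habs.trans_lt (gaussProd_succ_lt_half h0 h1 hirr k))
    rw [round_eq, Int.floor_eq_iff]
    constructor <;> linarith [hlt.1, hlt.2]
  rw [dlt, nint, hround, habs]

/-- Bounds for alternating sums of the `gaussProd α` with digits bounded by partial quotients. -/
theorem alternating_sum_bounds {α : ℝ} (h0 : 0 < α) (h1 : α < 1) (hirr : Irrational α)
    (b : ℕ → ℕ) (M m : ℕ) (hb : ∀ j < M, b (m + 1 + j) ≤ pq α (m + 1 + j + 1)) :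
    -gaussProd α (m + 1) <
        ∑ j ∈ Finset.range M, (-1 : ℝ) ^ j * b (m + 1 + j) * gaussProd α (m + 1 + j) ∧
      ∑ j ∈ Finset.range M, (-1 : ℝ) ^ j * b (m + 1 + j) * gaussProd α (m + 1 + j) <
        gaussProd α m ∧
      (0 < M → 0 < b (m + 1) →
        0 < ∑ j ∈ Finset.range M, (-1 : ℝ) ^ j * b (m + 1 + j) * gaussProd α (m + 1 + j)) := by
  induction M generalizing m with
  | zero => simp [gaussProd_pos h0 h1 hirr]
  | succ M ih =>
    obtain ⟨hl, hu, -⟩ := ih (m + 1) fun j hj => by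
      rw [add_assoc (m + 1), add_comm 1 j]
      exact hb (j + 1) (by lia)
    have hsum : ∑ j ∈ Finset.range (M + 1),
          (-1 : ℝ) ^ j * b (m + 1 + j) * gaussProd α (m + 1 + j) =
        b (m + 1) * gaussProd α (m + 1) - ∑ j ∈ Finset.range M,
          (-1 : ℝ) ^ j * b (m + 1 + 1 + j) * gaussProd α (m + 1 + 1 + j) := by
      rw [Finset.sum_range_succ', add_comm, sub_eq_add_neg, ← Finset.sum_neg_distrib]
      congr 1
      · simp
      · refine Finset.sum_congr rfl fun j _ => ?_
        rw [show m + 1 + (j + 1) = m + 1 + 1 + j by ring]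
        ring
    have hrec := gaussProd_add_two h0 h1 hirr m
    have hpos := gaussProd_pos h0 h1 hirr (m + 1)
    have hle : (b (m + 1) : ℝ) * gaussProd α (m + 1) ≤ pq α (m + 2) * gaussProd α (m + 1) :=
      mul_le_mul_of_nonneg_right (mod_cast hb 0 M.succ_pos) hpos.le
    have hnonneg : 0 ≤ (b (m + 1) : ℝ) * gaussProd α (m + 1) := by positivity
    rw [hsum]
    refine ⟨by linarith, by linarith, fun _ hbpos => ?_⟩
    have hone : (1 : ℝ) ≤ b (m + 1) := mod_cast hbpos
    nlinarith

/-- The sign of `ε_{k,0}(N)`: it vanishes if all higher Ostrowski digits vanish;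
otherwise it is positive when the first index `r* ≥ 1` with `b_{k+r*} > 0` is even,
and negative when `r*` is odd. -/
theorem eps_zero_sign
    (α : ℝ) (h0 : 0 < α) (h1 : α < 1) (hirr : Irrational α)
    (n N : ℕ) (b : ℕ → ℕ)
    (hqN : qden α n ≤ N) (hNq : N < qden α (n + 1))
    (hN : N = ∑ ℓ ∈ Finset.range (n + 1), b ℓ * qden α ℓ)
    (hbn : 1 ≤ b n) (hb0 : b 0 < pq α 1)
    (hb : ∀ ℓ, 1 ≤ ℓ → ℓ ≤ n → b ℓ ≤ pq α (ℓ + 1))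
    (hbz : ∀ ℓ, 1 ≤ ℓ → ℓ ≤ n → b ℓ = pq α (ℓ + 1) → b (ℓ - 1) = 0)
    (k : ℕ) (hk : k ≤ n) :
    ((∀ r, 1 ≤ r → r ≤ n - k → b (k + r) = 0) → eps α b n k 0 = 0) ∧
    (∀ rstar, 1 ≤ rstar → rstar ≤ n - k → 0 < b (k + rstar) →
      (∀ r, 1 ≤ r → r < rstar → b (k + r) = 0) →
      (Even rstar → 0 < eps α b n k 0) ∧ (Odd rstar → eps α b n k 0 < 0)) := by
  constructor
  · intro hz
    have hsum : ∑ j ∈ Finset.Icc 1 (n - k),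
        (-1 : ℝ) ^ j * b (k + j) * dlt α (k + j) = 0 := by
      refine Finset.sum_eq_zero fun j hj => ?_
      rw [Finset.mem_Icc] at hj
      simp [hz j hj.1 hj.2]
    simp [eps, hsum]
  · intro r hr hrn hbr hz
    obtain ⟨m, hm⟩ : ∃ m, k + r = m + 1 := ⟨k + r - 1, by lia⟩
    obtain ⟨-, -, hpos⟩ := alternating_sum_bounds h0 h1 hirr b (n - k + 1 - r) m
      fun j hj => hb _ (by lia) (by lia)
    have hS := hpos (by lia) (hm ▸ hbr)
    have hsum : ∑ j ∈ Finset.Icc 1 (n - k), (-1 : ℝ) ^ j * b (k + j) * dlt α (k + j) =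
        (-1) ^ r * ∑ j ∈ Finset.range (n - k + 1 - r),
          (-1 : ℝ) ^ j * b (m + 1 + j) * gaussProd α (m + 1 + j) := by
      have hsub : Finset.Ico r (n - k + 1) ⊆ Finset.Icc 1 (n - k) := fun j hj => by
        rw [Finset.mem_Ico] at hj
        rw [Finset.mem_Icc]
        lia
      rw [← Finset.sum_subset hsub, Finset.sum_Ico_eq_sum_range, Finset.mul_sum]
      · refine Finset.sum_congr rfl fun j _ => ?_
        rw [← add_assoc, hm, add_right_comm m 1 j, dlt_succ h0 h1 hirr]
        ring
      · intro j hj hj'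
        rw [Finset.mem_Icc] at hj
        rw [Finset.mem_Ico] at hj'
        simp [hz j hj.1 (by lia)]
    have hq : (0 : ℝ) < qden α k := mod_cast qden_pos h0 h1 hirr k
    rw [eps, hsum, Nat.cast_zero, zero_mul, zero_add]
    refine ⟨fun he => ?_, fun ho => ?_⟩
    · rw [he.neg_one_pow, one_mul]
      exact mul_pos hq hS
    · rw [ho.neg_one_pow, neg_one_mul]
      exact mul_neg_of_pos_of_neg hq (neg_lt_zero.2 hS)
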